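/- arXiv:2312.03949 — 2 statements merged into one kernel-verified Lean document; each statement's English description precedes it below -/
import Mathlib

section
/- Let Γ_N be the simple graph whose vertex set V is the set of primes p with p ≢ 3 (mod 4), two distinct vertices p, q being adjacent exactly when (p/q) = −1. Then the cycle space of Γ_N is generated by triangles: for any cycle, i.e. any closed walk through distinct vertices v₁, …, v_k with all edges {v₁,v₂}, {v₂,v₃}, …, {v_k,v₁} in Γ_N, the indicator vector of its edge set, viewed in the 𝔽₂-vector space of finitely supported 𝔽₂-valued functions on the edge set of Γ_N, lies in the 𝔽₂-span of the indicator vectors of the edge sets {{p,q}, {q,r}, {r,p}} of triangles of Γ_N (triples of primes p, q, r in V with (p/q) = (q/r) = (r/p) = −1). -/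
open scoped Classical in
noncomputable def legSym (a : ℤ) (p : ℕ) : ℤ :=
  if p = 2 then (if a % 8 = 1 ∨ a % 8 = 7 then 1 else -1)
  else if ∃ x : ℤ, (p : ℤ) ∣ (x ^ 2 - a) then 1 else -1

theorem legSym_eq_neg_one_iff {a : ℤ} {p : ℕ} (hp : p ≠ 2) :
    legSym a p = -1 ↔ ¬ IsSquare (a : ZMod p) := by
  have key : (∃ x : ℤ, (p : ℤ) ∣ (x ^ 2 - a)) ↔ IsSquare (a : ZMod p) := by
    constructor
    · rintro ⟨x, hx⟩
      refine ⟨(x : ZMod p), ?_⟩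
      have h := (ZMod.intCast_zmod_eq_zero_iff_dvd _ p).2 hx
      push_cast at h
      rw [← sub_eq_zero, ← neg_sub, ← sq, h, neg_zero]
    · rintro ⟨y, hy⟩
      obtain ⟨x, rfl⟩ := ZMod.intCast_surjective y
      refine ⟨x, (ZMod.intCast_zmod_eq_zero_iff_dvd _ p).1 ?_⟩
      push_cast
      rw [hy]
      ring
  unfold legSym
  rw [if_neg hp]
  split_ifs with h
  · simp [key.1 h]
  · simp [mt key.2 h]

theorem legSym_two_eq_neg_one {a : ℕ} (ha : a % 8 = 5) : legSym a 2 = -1 := by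
  unfold legSym
  rw [if_pos rfl, if_neg (by omega)]

/-- A residue class modulo `8` (for `p = 2`) or modulo `p` (for odd `p`) all of whose members
have symbol `-1` at `p`. -/
theorem exists_residue_legSym_eq_neg_one {p : ℕ} (hp : p.Prime) :
    ∃ a : ℕ, a.Coprime (if p = 2 then 8 else p) ∧
      ∀ n : ℕ, n ≡ a [MOD (if p = 2 then 8 else p)] →
        legSym n p = -1 ∧ (p = 2 → n % 8 = 5) := by
  by_cases h2 : p = 2
  · subst h2
    refine ⟨5, by norm_num, fun n hn => ?_⟩
    have h5 : n % 8 = 5 := hn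
    exact ⟨legSym_two_eq_neg_one h5, fun _ => h5⟩
  · simp only [if_neg h2]
    have := Fact.mk hp
    obtain ⟨y, hy⟩ := FiniteField.exists_nonsquare (F := ZMod p) (by rwa [ZMod.ringChar_zmod_n])
    have hy0 : y ≠ 0 := by
      rintro rfl
      exact hy ⟨0, by simp⟩
    refine ⟨y.val, ?_, fun n hn => ⟨?_, fun h => absurd h h2⟩⟩
    · rw [← ZMod.isUnit_iff_coprime, ZMod.natCast_zmod_val]
      exact hy0.isUnit
    · rw [legSym_eq_neg_one_iff h2]
      have h := (ZMod.natCast_eq_natCast_iff _ _ _).2 hn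
      rw [ZMod.natCast_zmod_val] at h
      rwa [Int.cast_natCast, h]

theorem legSym_symm_of_mod_eight_eq_five {p w : ℕ} (hp : p.Prime) (hp4 : p % 4 ≠ 3)
    (hw : w.Prime) (hw8 : w % 8 = 5) (h : legSym w p = -1) :
    legSym p w = -1 := by
  have := Fact.mk hp
  have := Fact.mk hw
  have hw2 : w ≠ 2 := by omega
  rw [legSym_eq_neg_one_iff hw2, Int.cast_natCast]
  by_cases h2 : p = 2
  · subst h2
    rw [Nat.cast_ofNat, ZMod.exists_sq_eq_two_iff hw2]
    omega
  · rw [legSym_eq_neg_one_iff h2, Int.cast_natCast] at h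
    rwa [ZMod.exists_sq_eq_prime_iff_of_mod_four_eq_one (p := w) (q := p) (by omega) h2]

/-- Every finite set of primes not congruent to `3` modulo `4` has a common neighbour. -/
theorem exists_prime_legSym_eq_neg_one (S : Finset ℕ) (hS : ∀ p ∈ S, p.Prime ∧ p % 4 ≠ 3) :
    ∃ w : ℕ, w.Prime ∧ w % 4 ≠ 3 ∧ w ∉ S ∧
      ∀ p ∈ S, legSym w p = -1 ∧ legSym p w = -1 := by
  classical
  set T := insert 2 S
  have hTp : ∀ p ∈ T, p.Prime := by
    intro p hp
    rcases Finset.mem_insert.1 hp with rfl | h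
    · exact Nat.prime_two
    · exact (hS p h).1
  let m : ℕ → ℕ := fun p => if p = 2 then 8 else p
  have hm0 : ∀ p ∈ T, m p ≠ 0 := by
    intro p hp
    have := (hTp p hp).ne_zero
    dsimp only [m]
    split_ifs <;> omega
  have hex : ∀ p : ℕ, ∃ a : ℕ, p ∈ T → a.Coprime (m p) ∧
      ∀ n : ℕ, n ≡ a [MOD m p] → legSym n p = -1 ∧ (p = 2 → n % 8 = 5) := by
    intro p
    by_cases hp : p ∈ T
    · obtain ⟨a, ha⟩ := exists_residue_legSym_eq_neg_one (hTp p hp)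
      exact ⟨a, fun _ => ha⟩
    · exact ⟨0, fun h => absurd h hp⟩
  choose a ha using hex
  have hco : Set.Pairwise (T : Set ℕ) (fun p q => (m p).Coprime (m q)) := by
    intro p hp q hq hpq
    have h := (Nat.coprime_primes (hTp p hp) (hTp q hq)).2 hpq
    dsimp only [m]
    split_ifs with h1 h2 h2
    · omega
    · subst h1
      exact Nat.Coprime.pow_left 3 h
    · subst h2
      exact Nat.Coprime.pow_right 3 h
    · exact h
  obtain ⟨b, hb⟩ := Nat.chineseRemainderOfFinset a m T hm0 hco
  have hbco : b.Coprime (∏ p ∈ T, m p) := by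
    refine Nat.Coprime.prod_right fun p hp => ?_
    rw [Nat.Coprime, (hb p hp).gcd_eq]
    exact (ha p hp).1
  obtain ⟨w, hwgt, hw, hwb⟩ := Nat.forall_exists_prime_gt_and_modEq (∑ p ∈ S, p)
    (Finset.prod_ne_zero_iff.2 hm0) hbco
  have hwT : ∀ p ∈ T, legSym w p = -1 ∧ (p = 2 → w % 8 = 5) := fun p hp =>
    (ha p hp).2 w ((hwb.of_dvd (Finset.dvd_prod_of_mem m hp)).trans (hb p hp))
  have hw8 : w % 8 = 5 := (hwT 2 (Finset.mem_insert_self _ _)).2 rfl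
  have hwS : w ∉ S := fun h =>
    absurd (Finset.single_le_sum (f := fun p : ℕ => p) (fun _ _ => Nat.zero_le _) h)
      (not_le.2 hwgt)
  refine ⟨w, hw, by omega, hwS, fun p hp => ?_⟩
  have h := (hwT p (Finset.mem_insert_of_mem hp)).1
  exact ⟨h, legSym_symm_of_mod_eight_eq_five (hS p hp).1 (hS p hp).2 hw hw8 h⟩

theorem injective_cycle_edges {V : Type*} {k : ℕ} (hk : 3 ≤ k) {v : ZMod k → V}
    (hinj : Function.Injective v) :
    Function.Injective fun i : ZMod k => s(v i, v (i + 1)) := by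
  intro i j hij
  rcases Sym2.eq_iff.1 hij with ⟨h, -⟩ | ⟨h1, h2⟩
  · exact hinj h
  · exfalso
    have e1 := hinj h1
    have e2 := hinj h2
    have h0 : ((2 : ℕ) : ZMod k) = 0 := by
      push_cast
      linear_combination e2 - e1
    have := Nat.le_of_dvd two_pos ((ZMod.natCast_eq_zero_iff 2 k).1 h0)
    omega

open scoped Classical in
theorem stmt_13 (k : ℕ) (hk : 3 ≤ k) (v : ZMod k → ℕ)
    (hinj : Function.Injective v)
    (hvert : ∀ i, (v i).Prime ∧ v i % 4 ≠ 3)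
    (hadj : ∀ i : ZMod k, legSym ((v i : ℕ) : ℤ) (v (i + 1)) = -1)
    (c : Sym2 ℕ →₀ ZMod 2)
    (hc : ∀ e : Sym2 ℕ, c e = if ∃ i : ZMod k, e = s(v i, v (i + 1)) then 1 else 0) :
    c ∈ Submodule.span (ZMod 2)
      {t : Sym2 ℕ →₀ ZMod 2 | ∃ p q r : ℕ,
        p.Prime ∧ q.Prime ∧ r.Prime ∧
        p % 4 ≠ 3 ∧ q % 4 ≠ 3 ∧ r % 4 ≠ 3 ∧
        p ≠ q ∧ q ≠ r ∧ r ≠ p ∧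
        legSym (p : ℤ) q = -1 ∧ legSym (q : ℤ) r = -1 ∧ legSym (r : ℤ) p = -1 ∧
        ∀ e : Sym2 ℕ, t e = if e = s(p, q) ∨ e = s(q, r) ∨ e = s(r, p) then 1 else 0} := by
  have : NeZero k := ⟨by omega⟩
  have : Fact (1 < k) := ⟨by omega⟩
  obtain ⟨w, hw, hw4, hwS, hwadj⟩ := exists_prime_legSym_eq_neg_one (Finset.univ.image v) (by
    intro p hp
    obtain ⟨i, -, rfl⟩ := Finset.mem_image.1 hp
    exact hvert i)
  have hmem : ∀ i, v i ∈ Finset.univ.image v := fun i =>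
    Finset.mem_image_of_mem v (Finset.mem_univ i)
  have hwne : ∀ i, v i ≠ w := fun i h => hwS (h ▸ hmem i)
  have hne : ∀ i, v i ≠ v (i + 1) := fun i h => by simpa using hinj h
  let δ : ℕ → ℕ → (Sym2 ℕ →₀ ZMod 2) := fun a b => Finsupp.single s(a, b) 1
  have hcycle : c = ∑ i, δ (v i) (v (i + 1)) := by
    ext e
    rw [hc, Finsupp.finsetSum_apply]
    simp only [δ, Finsupp.single_apply]
    split_ifs with h
    · obtain ⟨j, rfl⟩ := h
      simp only [(injective_cycle_edges hk hinj).eq_iff]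
      simp
    · refine (Finset.sum_eq_zero fun i _ => if_neg fun hi => h ⟨i, hi.symm⟩).symm
  have hshift : ∑ i, δ (v (i + 1)) w = ∑ i, δ (v i) w :=
    Equiv.sum_comp (Equiv.addRight (1 : ZMod k)) fun i => δ (v i) w
  have hcone : c = ∑ i, (δ (v i) (v (i + 1)) + δ (v (i + 1)) w + δ w (v i)) := by
    rw [Finset.sum_add_distrib, Finset.sum_add_distrib, ← hcycle,
      hshift, add_assoc,
      ← Finset.sum_add_distrib, Finset.sum_eq_zero, add_zero]
    intro i _
    simp only [δ]
    rw [Sym2.eq_swap, ← Finsupp.single_add, CharTwo.add_self_eq_zero, Finsupp.single_zero]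
  rw [hcone]
  refine Submodule.sum_mem _ fun i _ => Submodule.subset_span
    ⟨v i, v (i + 1), w, (hvert i).1, (hvert _).1, hw, (hvert i).2, (hvert _).2, hw4,
      hne i, hwne _, (hwne i).symm, hadj i, (hwadj _ (hmem _)).2, (hwadj _ (hmem _)).1, ?_⟩
  intro e
  have h1 : s(v i, v (i + 1)) ≠ s(v (i + 1), w) := by
    simp [hne, hwne]
  have h2 : s(v i, v (i + 1)) ≠ s(w, v i) := by
    simp [hwne]
  have h3 : s(v (i + 1), w) ≠ s(w, v i) := by
    simp [hwne, (hne i).symm]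
  simp only [δ, Finsupp.add_apply, Finsupp.single_apply, eq_comm (b := e)]
  by_cases e1 : e = s(v i, v (i + 1))
  · simp [e1, h1, h2]
  by_cases e2 : e = s(v (i + 1), w)
  · simp only [e2, h1.symm, h3, if_true, if_false, true_or, or_true, zero_add, add_zero]
  · simp only [e1, e2, if_false, false_or, zero_add]
end

section
/- Let Γ = (V, E) be a simple graph, possibly infinite. Equip the group ℰ(Γ) = 𝔽₂^E of all 𝔽₂-valued functions on E with the product topology of the discrete space 𝔽₂, and let 𝒢(Γ) = 𝔽₂^{⊕E} be the group of finitely supported 𝔽₂-valued functions on E, paired with ℰ(Γ) by ⟨F, G⟩ = Σ_{e ∈ supp(G)} F(e). Let ℬ(Γ) ⊆ ℰ(Γ) be the closed subgroup topologically generated by the indicator functions of the stars E(v) = {e ∈ E : v ∈ e} for v ∈ V, and let 𝒞(Γ) ⊆ 𝒢(Γ) be the subgroup generated by the indicator functions of edge sets of cycles {{v₁,v₂}, {v₂,v₃}, …, {v_k,v₁}} (v₁, …, v_k distinct vertices with all these edges in E). Then ℬ(Γ) and 𝒞(Γ) are mutual annihilators: ℬ(Γ) = {F ∈ ℰ(Γ)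 : ⟨F, G⟩ = 0 for all G ∈ 𝒞(Γ)} and 𝒞(Γ) = {G ∈ 𝒢(Γ) : ⟨F, G⟩ = 0 for all F ∈ ℬ(Γ)}. -/
/-- Give `𝔽₂ = ZMod 2` the discrete topology. -/
noncomputable instance : TopologicalSpace (ZMod 2) := ⊥
instance : DiscreteTopology (ZMod 2) := ⟨rfl⟩

namespace SimpleGraph

variable {V : Type*} (G : SimpleGraph V)

/-- The boundary of an unordered pair of vertices, as a `0`-chain over `𝔽₂`. -/
noncomputable def endpointChain : Sym2 V → (V →₀ ZMod 2) :=
  Sym2.lift ⟨fun a b => Finsupp.single a 1 + Finsupp.single b 1, fun _ _ => add_comm _ _⟩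

@[simp]
lemma endpointChain_mk (a b : V) :
    endpointChain s(a, b) = Finsupp.single a 1 + Finsupp.single b 1 := rfl

/-- The boundary map from finitely supported edge functions to finitely supported vertex
functions over `𝔽₂`. -/
noncomputable def boundary : (G.edgeSet →₀ ZMod 2) →ₗ[ZMod 2] (V →₀ ZMod 2) :=
  Finsupp.linearCombination (ZMod 2) fun e : G.edgeSet => endpointChain (e : Sym2 V)

open scoped Classical in
/-- The indicator function of the star of a vertex. -/
noncomputable def starIndicator (v : V) (e : G.edgeSet) : ZMod 2 :=
  if v ∈ (e : Sym2 V) then 1 else 0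

variable {G}

lemma boundary_apply (g : G.edgeSet →₀ ZMod 2) :
    G.boundary g = ∑ e ∈ g.support, g e • endpointChain (e : Sym2 V) := rfl

open scoped Classical in
/-- The function `g` is the indicator function of the edge set of a cycle of `G`. -/
def IsCycleIndicator (g : G.edgeSet →₀ ZMod 2) : Prop :=
  ∃ k : ℕ, 3 ≤ k ∧ ∃ v : ZMod k → V,
    Function.Injective v ∧ (∀ i, G.Adj (v i) (v (i + 1))) ∧
    ∀ e : G.edgeSet, g e =
      if ∃ i : ZMod k, (e : Sym2 V) = s(v i, v (i + 1)) then 1 else 0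

lemma sum_support_eq_linearCombination {α : Type*} (F : α → ZMod 2) (g : α →₀ ZMod 2) :
    ∑ e ∈ g.support, F e = Finsupp.linearCombination (ZMod 2) F g := by
  rw [Finsupp.linearCombination_apply, Finsupp.sum]
  refine Finset.sum_congr rfl fun e he => ?_
  have hge : g e = 1 := Fin.eq_one_of_ne_zero (g e) (Finsupp.mem_support_iff.mp he)
  rw [hge, one_smul]

lemma endpointChain_apply_eq_starIndicator (v : V) (e : G.edgeSet) :
    endpointChain (e : Sym2 V) v = G.starIndicator v e := by
  classical
  obtain ⟨e, he⟩ := e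
  induction e with
  | h a b =>
    have hab : a ≠ b := G.ne_of_adj he
    simp only [endpointChain_mk, starIndicator, Finsupp.add_apply, Finsupp.single_apply,
      Sym2.mem_iff]
    grind

lemma linearCombination_starIndicator (v : V) (g : G.edgeSet →₀ ZMod 2) :
    Finsupp.linearCombination (ZMod 2) (G.starIndicator v) g = G.boundary g v := by
  simp [boundary_apply, Finsupp.linearCombination_apply, Finsupp.sum, Finsupp.finsetSum_apply,
    endpointChain_apply_eq_starIndicator]

lemma boundary_eq_zero_iff (g : G.edgeSet →₀ ZMod 2) :
    G.boundary g = 0 ↔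
      ∀ v, Finsupp.linearCombination (ZMod 2) (G.starIndicator v) g = 0 := by
  simp only [linearCombination_starIndicator, Finsupp.ext_iff, Finsupp.zero_apply]

/-- Consecutive pairs of a cyclic sequence of at least three distinct vertices are distinct. -/
lemma injective_cyclic_edges {k : ℕ} (hk : 3 ≤ k) {v : ZMod k → V}
    (hv : Function.Injective v) : Function.Injective fun i => s(v i, v (i + 1)) := by
  intro i j hij
  simp only [Sym2.eq_iff] at hij
  rcases hij with h | ⟨h1, h2⟩
  · exact hv h.1
  · have h1 := hv h1
    have h2 := hv h2
    have h3 : ((2 : ℕ) : ZMod k) = 0 := by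
      push_cast
      linear_combination h2 - h1
    rw [ZMod.natCast_eq_zero_iff] at h3
    exact absurd (Nat.le_of_dvd two_pos h3) (by omega)

lemma IsCycleIndicator.boundary_eq_zero {g : G.edgeSet →₀ ZMod 2} (hg : IsCycleIndicator g) :
    G.boundary g = 0 := by
  classical
  obtain ⟨k, hk, v, hv, hadj, hg⟩ := hg
  have : NeZero k := ⟨by omega⟩
  have hsum : g = ∑ i : ZMod k,
      Finsupp.single (⟨s(v i, v (i + 1)), hadj i⟩ : G.edgeSet) (1 : ZMod 2) := by
    ext e
    rw [hg, Finsupp.finsetSum_apply]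
    split_ifs with h
    · obtain ⟨i, hi⟩ := h
      rw [Finset.sum_eq_single i]
      · rw [Finsupp.single_apply, if_pos (Subtype.ext hi.symm)]
      · intro j _ hji
        rw [Finsupp.single_apply, if_neg]
        intro hj
        exact hji (injective_cyclic_edges hk hv ((congrArg Subtype.val hj).trans hi))
      · simp
    · symm
      refine Finset.sum_eq_zero fun i _ => ?_
      rw [Finsupp.single_apply, if_neg]
      exact fun hi => h ⟨i, (congrArg Subtype.val hi).symm⟩
  have hshift : ∑ i : ZMod k, Finsupp.single (v (i + 1)) (1 : ZMod 2) =
      ∑ i : ZMod k, Finsupp.single (v i) (1 : ZMod 2) :=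
    Equiv.sum_comp (Equiv.addRight (1 : ZMod k)) fun i => Finsupp.single (v i) (1 : ZMod 2)
  rw [hsum, map_sum]
  simp only [boundary, Finsupp.linearCombination_single, one_smul, endpointChain_mk]
  rw [Finset.sum_add_distrib, hshift]
  exact ZModModule.add_self _

/-- A cycle of a subgraph gives the indicator function of a cycle, supported on the edges of
the subgraph. -/
lemma Walk.IsCycle.exists_isCycleIndicator {H : SimpleGraph V} (hH : H ≤ G) {u : V}
    {p : H.Walk u u} (hp : p.IsCycle) :
    ∃ c : G.edgeSet →₀ ZMod 2, IsCycleIndicator c ∧ c ≠ 0 ∧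
      ∀ e ∈ c.support, (e : Sym2 V) ∈ H.edgeSet := by
  classical
  have hk := hp.three_le_length
  have : NeZero p.length := ⟨by omega⟩
  set v : ZMod p.length → V := fun i => p.getVert i.val with hvdef
  have hsucc (i : ZMod p.length) : v (i + 1) = p.getVert (i.val + 1) := by
    have hi := ZMod.val_lt i
    have : Fact (1 < p.length) := ⟨by omega⟩
    simp only [hvdef]
    rw [ZMod.val_add, ZMod.val_one]
    rcases Nat.lt_or_ge (i.val + 1) p.length with h | h
    · rw [Nat.mod_eq_of_lt h]
    · have h : i.val + 1 = p.length := by omega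
      rw [h, Nat.mod_self, Walk.getVert_zero, Walk.getVert_length]
  have hadj (i : ZMod p.length) : H.Adj (v i) (v (i + 1)) := by
    rw [hsucc]
    exact p.adj_getVert_succ (ZMod.val_lt i)
  have hv : Function.Injective v := by
    intro i j hij
    have hi := ZMod.val_lt i
    have hj := ZMod.val_lt j
    exact ZMod.val_injective _ (hp.getVert_injOn' (Set.mem_ofPred.mpr (by omega))
      (Set.mem_ofPred.mpr (by omega)) hij)
  let s : Finset G.edgeSet :=
    Finset.univ.image fun i => (⟨s(v i, v (i + 1)), hH (hadj i)⟩ : G.edgeSet)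
  have hmem (e : G.edgeSet) : e ∈ s ↔ ∃ i, (e : Sym2 V) = s(v i, v (i + 1)) := by
    simp [s, Subtype.ext_iff, eq_comm]
  let c : G.edgeSet →₀ ZMod 2 := Finsupp.indicator s fun _ _ => 1
  have hc (e : G.edgeSet) :
      c e = if ∃ i, (e : Sym2 V) = s(v i, v (i + 1)) then 1 else 0 := by
    simp [c, Finsupp.indicator_apply, hmem]
  refine ⟨c, ⟨p.length, hk, v, hv, fun i => hH (hadj i), fun e => ?_⟩, ?_, ?_⟩
  · convert hc e
  · intro h0
    have h := hc ⟨s(v 0, v (0 + 1)), hH (hadj 0)⟩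
    rw [if_pos ⟨0, rfl⟩, h0] at h
    exact zero_ne_one h
  · intro e he
    rw [Finsupp.mem_support_iff, hc] at he
    obtain ⟨i, hi⟩ : ∃ i, (e : Sym2 V) = s(v i, v (i + 1)) := by
      by_contra h
      exact he (if_neg h)
    rw [hi]
    exact hadj i

/-- The support of a nonzero edge function with zero boundary contains a cycle. -/
lemma exists_isCycleIndicator_support_subset {g : G.edgeSet →₀ ZMod 2} (hg : G.boundary g = 0)
    (h0 : g ≠ 0) :
    ∃ c : G.edgeSet →₀ ZMod 2, IsCycleIndicator c ∧ c ≠ 0 ∧ c.support ⊆ g.support := by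
  classical
  set H : SimpleGraph V := fromEdgeSet (Subtype.val '' (g.support : Set G.edgeSet)) with hHdef
  have hH : H ≤ G := by
    intro a b hab
    rw [hHdef, fromEdgeSet_adj] at hab
    obtain ⟨⟨⟨e, he⟩, -, rfl⟩, -⟩ := hab
    exact he
  obtain ⟨⟨e, he⟩, heg⟩ := Finsupp.support_nonempty_iff.mpr h0
  induction e with
  | h a b =>
    have hab : H.Adj a b := by
      rw [hHdef, fromEdgeSet_adj]
      exact ⟨⟨_, heg, rfl⟩, G.ne_of_adj he⟩
    have hreach : (H \ fromEdgeSet {s(a, b)}).Reachable a b := by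
      by_contra hnot
      set K := H \ fromEdgeSet {s(a, b)} with hK
      -- Pair the boundary with the indicator function of the component of `a` in `K`.
      let x : V → ZMod 2 := fun w => if K.Reachable a w then 1 else 0
      have hx := congrArg (Finsupp.linearCombination (ZMod 2) x) hg
      rw [map_zero, boundary_apply, map_sum,
        Finset.sum_eq_single_of_mem _ heg] at hx
      · rw [map_smul, endpointChain_mk, map_add, Finsupp.linearCombination_single,
          Finsupp.linearCombination_single] at hx
        simp only [x, if_neg hnot, if_pos (Reachable.refl (G := K) a)] at hx
        simp at hx
        exact Finsupp.mem_support_iff.mp heg hx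
      · rintro ⟨f, hf⟩ hfg hne
        induction f with
        | h y z =>
          have hyz : K.Adj y z := by
            rw [hK, sdiff_adj, fromEdgeSet_adj, fromEdgeSet_adj]
            refine ⟨⟨⟨_, hfg, rfl⟩, G.ne_of_adj hf⟩, fun h => hne (Subtype.ext h.1)⟩
          have hiff : K.Reachable a y ↔ K.Reachable a z :=
            ⟨fun h => h.trans hyz.reachable, fun h => h.trans hyz.symm.reachable⟩
          have hxyz : x y = x z := by simp only [x, hiff]
          rw [map_smul, endpointChain_mk, map_add, Finsupp.linearCombination_single,
            Finsupp.linearCombination_single, hxyz, ZModModule.add_self, smul_zero]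
    obtain ⟨u, p, hp, -⟩ := adj_and_reachable_delete_edges_iff_exists_cycle.mp ⟨hab, hreach⟩
    obtain ⟨c, hc, hc0, hsupp⟩ := hp.exists_isCycleIndicator hH
    refine ⟨c, hc, hc0, fun f hf => ?_⟩
    have hfH := hsupp f hf
    rw [hHdef, edgeSet_fromEdgeSet] at hfH
    obtain ⟨⟨e, heg, hef⟩, -⟩ := hfH
    rwa [Subtype.ext hef] at heg

/-- The cycle space is the kernel of the boundary map. -/
lemma mem_closure_isCycleIndicator_iff (g : G.edgeSet →₀ ZMod 2) :
    g ∈ AddSubgroup.closure {c : G.edgeSet →₀ ZMod 2 | IsCycleIndicator c} ↔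
      G.boundary g = 0 := by
  classical
  constructor
  · intro hg
    have hle : AddSubgroup.closure {c : G.edgeSet →₀ ZMod 2 | IsCycleIndicator c} ≤
        G.boundary.toAddMonoidHom.ker :=
      (AddSubgroup.closure_le _).mpr fun c hc => hc.boundary_eq_zero
    exact hle hg
  · induction hn : g.support.card using Nat.strong_induction_on generalizing g with
    | _ n ih =>
      intro hg
      by_cases h0 : g = 0
      · rw [h0]
        exact zero_mem _
      obtain ⟨c, hc, hc0, hsub⟩ := exists_isCycleIndicator_support_subset hg h0
      have hlt : (g - c).support ⊂ g.support := by
        rw [Finset.ssubset_iff_of_subset]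
        · obtain ⟨e, he⟩ := Finsupp.support_nonempty_iff.mpr hc0
          refine ⟨e, hsub he, ?_⟩
          have hge := hsub he
          rw [Finsupp.mem_support_iff] at he hge
          rw [Finsupp.notMem_support_iff, Finsupp.sub_apply, Fin.eq_one_of_ne_zero _ he,
            Fin.eq_one_of_ne_zero _ hge]
          exact sub_self _
        · exact Finsupp.support_sub.trans (Finset.union_subset subset_rfl hsub)
      have hmem := ih _ (hn ▸ Finset.card_lt_card hlt) (g - c) rfl
        (by rw [map_sub, hg, hc.boundary_eq_zero, sub_zero])
      simpa using add_mem hmem (AddSubgroup.subset_closure hc)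

end SimpleGraph

/-- A function pairing to zero with every finitely supported function annihilating an additive
subgroup `D` of `𝔽₂^α` lies in the closure of `D`. -/
lemma AddSubgroup.mem_topologicalClosure_of_forall_linearCombination_eq_zero {α : Type*}
    (D : AddSubgroup (α → ZMod 2)) (F : α → ZMod 2)
    (hF : ∀ g : α →₀ ZMod 2, (∀ F' ∈ D, Finsupp.linearCombination (ZMod 2) F' g = 0) →
      Finsupp.linearCombination (ZMod 2) F g = 0) :
    F ∈ D.topologicalClosure := by
  classical
  rw [← SetLike.mem_coe, AddSubgroup.topologicalClosure_coe, mem_closure_iff]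
  intro o ho hFo
  obtain ⟨I, u, hu, hIo⟩ := isOpen_pi_iff.mp ho F hFo
  let r : (α → ZMod 2) →ₗ[ZMod 2] (I → ZMod 2) := LinearMap.funLeft (ZMod 2) (ZMod 2) (↑)
  by_cases hrF : r F ∈ (AddSubgroup.toZModSubmodule 2 D).map r
  · obtain ⟨F', hF', hrF'⟩ := Submodule.mem_map.mp hrF
    refine ⟨F', hIo fun i hi => ?_, hF'⟩
    have hi' : F' i = F i := congrFun hrF' ⟨i, hi⟩
    rw [hi']
    exact (hu i hi).2
  · exfalso
    obtain ⟨f, hfF, hfD⟩ := Submodule.exists_le_ker_of_notMem hrF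
    let g : α →₀ ZMod 2 := ∑ i : I, Finsupp.single (i : α) (f (Pi.single i 1))
    have hg (F' : α → ZMod 2) : Finsupp.linearCombination (ZMod 2) F' g = f (r F') := by
      rw [LinearMap.pi_apply_eq_sum_univ f (r F'), map_sum]
      refine Finset.sum_congr rfl fun i _ => ?_
      rw [Finsupp.linearCombination_single, smul_eq_mul, smul_eq_mul, mul_comm]
      congr 2
      ext j
      simp [Pi.single_apply, eq_comm]
    have hgD : ∀ F' ∈ D, Finsupp.linearCombination (ZMod 2) F' g = 0 := fun F' hF' =>
      (hg F').trans (hfD (Submodule.mem_map_of_mem hF'))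
    exact hfF (hg F ▸ hF g hgD)

/-- The functions annihilated by a fixed finitely supported function form a closed set. -/
lemma AddSubgroup.linearCombination_eq_zero_of_mem_topologicalClosure {α : Type*}
    {s : Set (α → ZMod 2)} {F : α → ZMod 2}
    (hF : F ∈ (AddSubgroup.closure s).topologicalClosure) {g : α →₀ ZMod 2}
    (hg : ∀ F' ∈ s, Finsupp.linearCombination (ZMod 2) F' g = 0) :
    Finsupp.linearCombination (ZMod 2) F g = 0 := by
  let φ : (α → ZMod 2) →+ ZMod 2 :=
    { toFun := fun F' => ∑ e ∈ g.support, F' e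
      map_zero' := by simp
      map_add' := fun _ _ => by simp [Finset.sum_add_distrib] }
  have hφ (F' : α → ZMod 2) : φ F' = Finsupp.linearCombination (ZMod 2) F' g :=
    SimpleGraph.sum_support_eq_linearCombination F' g
  have hclosed : IsClosed (φ.ker : Set (α → ZMod 2)) := by
    have hcont : Continuous φ := continuous_finsetSum _ fun e _ => continuous_apply e
    exact (isClosed_discrete {(0 : ZMod 2)}).preimage hcont
  have hle : AddSubgroup.closure s ≤ φ.ker :=
    (AddSubgroup.closure_le _).mpr fun F' hF' => (hφ F').trans (hg F' hF')
  exact (hφ F).symm.trans (AddSubgroup.topologicalClosure_minimal _ hle hclosed hF)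

open scoped Classical in
theorem stmt_14 (V : Type) (G : SimpleGraph V)
    (B : AddSubgroup (G.edgeSet → ZMod 2))
    (hB : B = (AddSubgroup.closure
      {F : G.edgeSet → ZMod 2 | ∃ v : V,
        ∀ e : G.edgeSet, F e = if v ∈ (e : Sym2 V) then 1 else 0}).topologicalClosure)
    (C : AddSubgroup (G.edgeSet →₀ ZMod 2))
    (hC : C = AddSubgroup.closure
      {g : G.edgeSet →₀ ZMod 2 | ∃ k : ℕ, 3 ≤ k ∧ ∃ v : ZMod k → V,
        Function.Injective v ∧ (∀ i, G.Adj (v i) (v (i + 1))) ∧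
        ∀ e : G.edgeSet, g e =
          if ∃ i : ZMod k, (e : Sym2 V) = s(v i, v (i + 1)) then 1 else 0}) :
    (∀ F : G.edgeSet → ZMod 2,
      F ∈ B ↔ ∀ g : G.edgeSet →₀ ZMod 2, g ∈ C → ∑ e ∈ g.support, F e = 0) ∧
    (∀ g : G.edgeSet →₀ ZMod 2,
      g ∈ C ↔ ∀ F : G.edgeSet → ZMod 2, F ∈ B → ∑ e ∈ g.support, F e = 0) := by
  have hstar : {F : G.edgeSet → ZMod 2 | ∃ v : V,
      ∀ e : G.edgeSet, F e = if v ∈ (e : Sym2 V) then 1 else 0} =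
      Set.range G.starIndicator := by
    ext F
    exact exists_congr fun v => ⟨fun h => (funext h).symm, fun h e => congrFun h.symm e⟩
  have hmemC (g : G.edgeSet →₀ ZMod 2) : g ∈ C ↔ G.boundary g = 0 := by
    rw [hC]
    exact SimpleGraph.mem_closure_isCycleIndicator_iff g
  rw [hstar] at hB
  have hstarB (v : V) : G.starIndicator v ∈ AddSubgroup.closure (Set.range G.starIndicator) :=
    AddSubgroup.subset_closure ⟨v, rfl⟩
  have horth (F : G.edgeSet → ZMod 2) (hF : F ∈ B) (g : G.edgeSet →₀ ZMod 2) (hg : g ∈ C) :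
      Finsupp.linearCombination (ZMod 2) F g = 0 := by
    rw [hB] at hF
    refine AddSubgroup.linearCombination_eq_zero_of_mem_topologicalClosure hF ?_
    rintro _ ⟨v, rfl⟩
    exact (SimpleGraph.boundary_eq_zero_iff g).mp ((hmemC g).mp hg) v
  simp only [SimpleGraph.sum_support_eq_linearCombination]
  refine ⟨fun F => ⟨horth F, fun h => ?_⟩, fun g => ⟨fun hg F hF => horth F hF g hg, fun h => ?_⟩⟩
  · rw [hB]
    refine AddSubgroup.mem_topologicalClosure_of_forall_linearCombination_eq_zero _ F
      fun g hg => h g ?_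
    rw [hmemC, SimpleGraph.boundary_eq_zero_iff]
    exact fun v => hg _ (hstarB v)
  · rw [hmemC, SimpleGraph.boundary_eq_zero_iff]
    exact fun v => h _ (hB ▸ AddSubgroup.le_topologicalClosure _ (hstarB v))
end
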